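/- Let u₁, u₂, v₁, v₂ ∈ ℂ with u₁−u₂, v₁−u₂, u₁−v₂ ∉ ℤ_{≤0}. Define Ř = D₂[u₁−u₂, v₁−u₂] ∘ D₁[u₁−v₂, u₁−u₂] on ℂ[z₁,z₂], where D₂[α,β](z₁ʲ(z₂−z₁)ᵏ) = (Γ(k+α)/Γ(k+β)) z₁ʲ(z₂−z₁)ᵏ and D₁[α,β](z₂ʲ(z₁−z₂)ᵏ) = (Γ(k+α)/Γ(k+β)) z₂ʲ(z₁−z₂)ᵏ. Then the factorized operator Ř satisfies the full defining equation of the sl(2) R-matrix: Ř L₁(u₁,u₂) L₂(v₁,v₂) = L₁(v₁,v₂) L₂(u₁,u₂) Ř, as an identity of 2×2 matrices of operators (with Ř standing for Ř times the identity matrix). -/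

import Mathlib

open MvPolynomial

/-- Multiplication by `zᵢ` on `ℂ[z₁,z₂]` (indices `0,1` for `1,2`). -/
noncomputable def Zm (i : Fin 2) : Module.End ℂ (MvPolynomial (Fin 2) ℂ) :=
  LinearMap.mulLeft ℂ (X i)

/-- Partial derivative `∂ᵢ = ∂/∂zᵢ` on `ℂ[z₁,z₂]`. -/
noncomputable def Dm (i : Fin 2) : Module.End ℂ (MvPolynomial (Fin 2) ℂ) :=
  (pderiv i).toLinearMap

/-- The `sl(2)` Lax matrix `Lᵢ(a,b) = [[a + zᵢ∂ᵢ, −∂ᵢ], [zᵢ²∂ᵢ + (a−b)zᵢ, b − zᵢ∂ᵢ]]`. -/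
noncomputable def Lax (i : Fin 2) (a b : ℂ) :
    Matrix (Fin 2) (Fin 2) (Module.End ℂ (MvPolynomial (Fin 2) ℂ)) :=
  !![a • 1 + Zm i * Dm i, -Dm i;
     Zm i * Zm i * Dm i + (a - b) • Zm i, b • 1 - Zm i * Dm i]

/-- The scalar 2×2 matrix `R·Id`. -/
noncomputable def SM (R : Module.End ℂ (MvPolynomial (Fin 2) ℂ)) :
    Matrix (Fin 2) (Fin 2) (Module.End ℂ (MvPolynomial (Fin 2) ℂ)) :=
  Matrix.scalar (Fin 2) R

/-- The Euler operator `(zᵢ−zⱼ)∂ᵢ`. -/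
noncomputable def eulerOp (i j : Fin 2) : Module.End ℂ (MvPolynomial (Fin 2) ℂ) :=
  (Zm i - Zm j) * Dm i

/-- The operator `∂ᵢ((zᵢ−zⱼ)∂ᵢ + a − 1)`. -/
noncomputable def loweringOp (i j : Fin 2) (a : ℂ) : Module.End ℂ (MvPolynomial (Fin 2) ℂ) :=
  Dm i * (eulerOp i j + (a - 1) • 1)

/-- The operator `(zᵢ−zⱼ)((zᵢ−zⱼ)∂ᵢ + b)`. -/
noncomputable def raisingOp (i j : Fin 2) (b : ℂ) : Module.End ℂ (MvPolynomial (Fin 2) ℂ) :=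
  (Zm i - Zm j) * (eulerOp i j + b • 1)

lemma Zm_apply (i : Fin 2) (p : MvPolynomial (Fin 2) ℂ) : Zm i p = X i * p := rfl

lemma Dm_apply (i : Fin 2) (p : MvPolynomial (Fin 2) ℂ) : Dm i p = pderiv i p := rfl

lemma pderiv_pderiv_comm (i j : Fin 2) (p : MvPolynomial (Fin 2) ℂ) :
    pderiv i (pderiv j p) = pderiv j (pderiv i p) := by
  have h : ⁅pderiv (R := ℂ) i, pderiv (R := ℂ) j⁆ = 0 := by
    refine derivation_ext fun k => ?_
    simp [Derivation.commutator_apply, pderiv_X, Pi.single_apply, apply_ite]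
  have hp := congrArg (fun d : Derivation ℂ _ _ => d p) h
  simpa [Derivation.commutator_apply, sub_eq_zero] using hp

/-- Linear endomorphisms agreeing on all `zⱼᵐ(zᵢ−zⱼ)ᵏ` are equal. -/
lemma end_ext_of_shifted_monomials {i j : Fin 2} (hij : i ≠ j)
    {S T : Module.End ℂ (MvPolynomial (Fin 2) ℂ)}
    (h : ∀ m k : ℕ, S (X j ^ m * (X i - X j) ^ k) = T (X j ^ m * (X i - X j) ^ k)) : S = T := by
  let s : Set (MvPolynomial (Fin 2) ℂ) :=
    Set.range fun mk : ℕ × ℕ => X j ^ mk.1 * (X i - X j) ^ mk.2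
  have hX : ∀ p ∈ Submodule.span ℂ s, X j * p ∈ Submodule.span ℂ s := by
    intro p hp
    induction hp using Submodule.span_induction with
    | mem q hq =>
      obtain ⟨⟨m, k⟩, rfl⟩ := hq
      exact Submodule.subset_span ⟨(m + 1, k), by simp only; ring⟩
    | zero => simp
    | add q r _ _ hq hr => rw [mul_add]; exact add_mem hq hr
    | smul c q _ hq => rw [mul_smul_comm]; exact Submodule.smul_mem _ c hq
  have hY : ∀ p ∈ Submodule.span ℂ s, (X i - X j) * p ∈ Submodule.span ℂ s := by
    intro p hp
    induction hp using Submodule.span_induction with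
    | mem q hq =>
      obtain ⟨⟨m, k⟩, rfl⟩ := hq
      exact Submodule.subset_span ⟨(m, k + 1), by simp only; ring⟩
    | zero => simp
    | add q r _ _ hq hr => rw [mul_add]; exact add_mem hq hr
    | smul c q _ hq => rw [mul_smul_comm]; exact Submodule.smul_mem _ c hq
  have hs : ∀ p, p ∈ Submodule.span ℂ s := by
    intro p
    induction p using MvPolynomial.induction_on with
    | C c =>
      rw [← mul_one (C c), ← smul_eq_C_mul]
      exact Submodule.smul_mem _ c (Submodule.subset_span ⟨(0, 0), by simp⟩)
    | add p q hp hq => exact add_mem hp hq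
    | mul_X p n hp =>
      rw [mul_comm]
      obtain rfl | rfl : n = j ∨ n = i := by omega
      · exact hX p hp
      · rw [show X n * p = (X n - X j) * p + X j * p by ring]
        exact add_mem (hY p hp) (hX p hp)
  refine LinearMap.ext_on_range (v := fun mk : ℕ × ℕ => X j ^ mk.1 * (X i - X j) ^ mk.2)
    (Submodule.eq_top_iff'.2 hs) fun mk => h mk.1 mk.2

lemma Dm_shifted_monomial {i j : Fin 2} (hij : i ≠ j) (m k : ℕ) :
    Dm i (X j ^ m * (X i - X j) ^ k) = (k : ℂ) • (X j ^ m * (X i - X j) ^ (k - 1)) := by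
  simp only [Dm_apply, Derivation.leibniz, Derivation.leibniz_pow, map_sub, pderiv_X_self,
    pderiv_X_of_ne hij.symm, smul_eq_mul, nsmul_eq_mul, smul_eq_C_mul, map_natCast]
  ring

lemma eulerOp_shifted_monomial {i j : Fin 2} (hij : i ≠ j) (m k : ℕ) :
    eulerOp i j (X j ^ m * (X i - X j) ^ k) = (k : ℂ) • (X j ^ m * (X i - X j) ^ k) := by
  rw [eulerOp, Module.End.mul_apply, Dm_shifted_monomial hij, map_smul, LinearMap.sub_apply,
    Zm_apply, Zm_apply]
  rcases k with _ | k
  · simp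
  · simp only [add_tsub_cancel_right]
    congr 1
    ring

lemma Dm_add_Dm_shifted_monomial {i j : Fin 2} (hij : i ≠ j) (m k : ℕ) :
    (Dm i + Dm j) (X j ^ m * (X i - X j) ^ k) = (m : ℂ) • (X j ^ (m - 1) * (X i - X j) ^ k) := by
  simp only [LinearMap.add_apply, Dm_apply, Derivation.leibniz, Derivation.leibniz_pow, map_sub,
    pderiv_X_self, pderiv_X_of_ne hij.symm, pderiv_X_of_ne hij, smul_eq_mul, nsmul_eq_mul,
    smul_eq_C_mul, map_natCast]
  ring

lemma commute_Zm {i j : Fin 2} (hij : i ≠ j) {D : Module.End ℂ (MvPolynomial (Fin 2) ℂ)}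
    {c : ℕ → ℂ}
    (hD : ∀ m k : ℕ, D (X j ^ m * (X i - X j) ^ k) = c k • (X j ^ m * (X i - X j) ^ k)) :
    Commute D (Zm j) := by
  refine end_ext_of_shifted_monomials hij fun m k => ?_
  rw [Module.End.mul_apply, Module.End.mul_apply, hD, map_smul, Zm_apply, ← mul_assoc, ← pow_succ',
    hD]

lemma commute_Dm_add_Dm {i j : Fin 2} (hij : i ≠ j) {D : Module.End ℂ (MvPolynomial (Fin 2) ℂ)}
    {c : ℕ → ℂ}
    (hD : ∀ m k : ℕ, D (X j ^ m * (X i - X j) ^ k) = c k • (X j ^ m * (X i - X j) ^ k)) :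
    Commute D (Dm i + Dm j) := by
  refine end_ext_of_shifted_monomials hij fun m k => ?_
  rw [Module.End.mul_apply, Module.End.mul_apply, hD, map_smul, Dm_add_Dm_shifted_monomial hij,
    map_smul, hD, smul_comm]

lemma commute_eulerOp {i j : Fin 2} (hij : i ≠ j) {D : Module.End ℂ (MvPolynomial (Fin 2) ℂ)}
    {c : ℕ → ℂ}
    (hD : ∀ m k : ℕ, D (X j ^ m * (X i - X j) ^ k) = c k • (X j ^ m * (X i - X j) ^ k)) :
    Commute D (eulerOp i j) := by
  refine end_ext_of_shifted_monomials hij fun m k => ?_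
  rw [Module.End.mul_apply, Module.End.mul_apply, hD, map_smul, eulerOp_shifted_monomial hij,
    map_smul, hD, smul_comm]

lemma semiconjBy_raisingOp {i j : Fin 2} (hij : i ≠ j) {D : Module.End ℂ (MvPolynomial (Fin 2) ℂ)}
    {c : ℕ → ℂ}
    (hD : ∀ m k : ℕ, D (X j ^ m * (X i - X j) ^ k) = c k • (X j ^ m * (X i - X j) ^ k))
    {a b : ℂ} (hc : ∀ k : ℕ, c (k + 1) * (k + b) = (k + a) * c k) :
    SemiconjBy D (raisingOp i j b) (raisingOp i j a) := by
  have raise : ∀ (d : ℂ) (m k : ℕ), raisingOp i j d (X j ^ m * (X i - X j) ^ k)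
      = (k + d) • (X j ^ m * (X i - X j) ^ (k + 1)) := by
    intro d m k
    simp only [raisingOp, Module.End.mul_apply, LinearMap.add_apply, LinearMap.smul_apply,
      Module.End.one_apply, LinearMap.sub_apply, eulerOp_shifted_monomial hij, Zm_apply,
      smul_eq_C_mul, map_add]
    ring
  refine end_ext_of_shifted_monomials hij fun m k => ?_
  rw [Module.End.mul_apply, Module.End.mul_apply, hD, map_smul, raise, raise, map_smul, hD,
    smul_smul, smul_smul, mul_comm, hc, mul_comm]

lemma semiconjBy_loweringOp {i j : Fin 2} (hij : i ≠ j) {D : Module.End ℂ (MvPolynomial (Fin 2) ℂ)}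
    {c : ℕ → ℂ}
    (hD : ∀ m k : ℕ, D (X j ^ m * (X i - X j) ^ k) = c k • (X j ^ m * (X i - X j) ^ k))
    {a b : ℂ} (hc : ∀ k : ℕ, c (k + 1) * (k + b) = (k + a) * c k) :
    SemiconjBy D (loweringOp i j a) (loweringOp i j b) := by
  have lower : ∀ (d : ℂ) (m k : ℕ), loweringOp i j d (X j ^ m * (X i - X j) ^ k)
      = ((k + (d - 1)) * k) • (X j ^ m * (X i - X j) ^ (k - 1)) := by
    intro d m k
    rw [loweringOp, Module.End.mul_apply, LinearMap.add_apply, LinearMap.smul_apply,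
      Module.End.one_apply, eulerOp_shifted_monomial hij, ← add_smul, map_smul,
      Dm_shifted_monomial hij, smul_smul]
  refine end_ext_of_shifted_monomials hij fun m k => ?_
  rw [Module.End.mul_apply, Module.End.mul_apply, hD, map_smul, lower, lower, map_smul, hD,
    smul_smul, smul_smul]
  congr 1
  rcases k with _ | k
  · simp
  · rw [add_tsub_cancel_right]
    push_cast
    linear_combination (-(k : ℂ) - 1) * hc k

lemma SemiconjBy.end_smul_right {D S T : Module.End ℂ (MvPolynomial (Fin 2) ℂ)}
    (h : SemiconjBy D S T) (r : ℂ) : SemiconjBy D (r • S) (r • T) := by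
  rw [SemiconjBy, mul_smul_comm, smul_mul_assoc, h.eq]

lemma semiconjBy_SM {D a b c d a' b' c' d' : Module.End ℂ (MvPolynomial (Fin 2) ℂ)}
    (ha : SemiconjBy D a a') (hb : SemiconjBy D b b') (hc : SemiconjBy D c c')
    (hd : SemiconjBy D d d') : SemiconjBy (SM D) !![a, b; c, d] !![a', b'; c', d'] := by
  rw [SemiconjBy, SM]
  ext1 s t
  fin_cases s <;> fin_cases t <;>
    simp [Matrix.mul_apply, Fin.sum_univ_two, ha.eq, hb.eq, hc.eq, hd.eq]

lemma end_smul_apply (r : ℂ) (T : Module.End ℂ (MvPolynomial (Fin 2) ℂ))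
    (p : MvPolynomial (Fin 2) ℂ) : (r • T) p = C r * T p := by
  rw [LinearMap.smul_apply, smul_eq_C_mul]

/-- `Lᵢ(p₁,p₂) Lⱼ(q₁,q₂)` in the coordinates `zⱼ`, `zᵢ−zⱼ`. -/
lemma Lax_mul_Lax_left {i j : Fin 2} (hij : i ≠ j) (p₁ p₂ q₁ q₂ : ℂ) :
    Lax i p₁ p₂ * Lax j q₁ q₂ =
      !![(p₁ * q₁) • 1 + p₁ • (Zm j * (Dm i + Dm j)) + q₁ • eulerOp i j
            + Zm j * (eulerOp i j * (Dm i + Dm j)) - Zm j * loweringOp i j (p₁ - q₂),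
        loweringOp i j (p₁ - q₂) - p₁ • (Dm i + Dm j) - eulerOp i j * (Dm i + Dm j);
        q₁ • raisingOp i j (p₁ - p₂) + Zm j * (raisingOp i j (p₁ - p₂) * (Dm i + Dm j))
            - Zm j * (Zm j * loweringOp i j (p₁ - q₂)) - Zm j * (eulerOp i j * eulerOp i j)
            + (q₁ + q₂ + p₂ - p₁ + 1) • (Zm j * eulerOp i j)
            + Zm j * (Zm j * (eulerOp i j * (Dm i + Dm j)))
            + p₁ • (Zm j * (Zm j * (Dm i + Dm j))) + (p₁ * q₁ - p₂ * q₂) • Zm j,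
        (p₂ * q₂) • 1 + Zm j * loweringOp i j (p₁ - q₂) - Zm j * (eulerOp i j * (Dm i + Dm j))
            - p₁ • (Zm j * (Dm i + Dm j)) - raisingOp i j (p₁ - p₂) * (Dm i + Dm j)
            + eulerOp i j * eulerOp i j + (p₁ - p₂ - q₂ - 1) • eulerOp i j] := by
  ext1 s t
  fin_cases s <;> fin_cases t <;> refine LinearMap.ext fun p => ?_ <;>
    simp only [Lax, eulerOp, loweringOp, raisingOp, Matrix.mul_apply, Fin.sum_univ_two,
      Fin.zero_eta, Fin.mk_one, Matrix.of_apply, Matrix.cons_val', Matrix.cons_val_zero,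
      Matrix.cons_val_one, Matrix.cons_val_fin_one, LinearMap.add_apply, LinearMap.sub_apply,
      LinearMap.neg_apply, end_smul_apply, Module.End.mul_apply, Module.End.one_apply, Zm_apply,
      Dm_apply, map_add, map_sub, map_neg, map_mul, map_one, Derivation.leibniz, pderiv_C,
      Derivation.map_one_eq_zero, pderiv_X_self, pderiv_X_of_ne hij.symm, smul_eq_mul] <;>
    ring

/-- `Lⱼ(p₁,p₂) Lᵢ(q₁,q₂)` in the coordinates `zⱼ`, `zᵢ−zⱼ`. -/
lemma Lax_mul_Lax_right {i j : Fin 2} (hij : i ≠ j) (p₁ p₂ q₁ q₂ : ℂ) :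
    Lax j p₁ p₂ * Lax i q₁ q₂ =
      !![(p₁ * q₁) • 1 + Zm j * loweringOp i j (p₁ - q₂) - Zm j * (eulerOp i j * (Dm i + Dm j))
            + q₂ • (Zm j * (Dm i + Dm j)) - raisingOp i j (q₁ - q₂) * (Dm i + Dm j)
            + eulerOp i j * eulerOp i j + (p₁ + q₁ - q₂ - 1) • eulerOp i j,
        eulerOp i j * (Dm i + Dm j) - q₂ • (Dm i + Dm j) - loweringOp i j (p₁ - q₂);
        p₂ • raisingOp i j (q₁ - q₂) - Zm j * (raisingOp i j (q₁ - q₂) * (Dm i + Dm j))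
            + Zm j * (Zm j * loweringOp i j (p₁ - q₂)) + Zm j * (eulerOp i j * eulerOp i j)
            + (p₁ + p₂ + q₁ - q₂ - 1) • (Zm j * eulerOp i j)
            - Zm j * (Zm j * (eulerOp i j * (Dm i + Dm j)))
            + q₂ • (Zm j * (Zm j * (Dm i + Dm j))) + (p₁ * q₁ - p₂ * q₂) • Zm j,
        (p₂ * q₂) • 1 + Zm j * (eulerOp i j * (Dm i + Dm j)) - Zm j * loweringOp i j (p₁ - q₂)
            - p₂ • eulerOp i j - q₂ • (Zm j * (Dm i + Dm j))] := by
  ext1 s t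
  fin_cases s <;> fin_cases t <;> refine LinearMap.ext fun p => ?_ <;>
    simp only [Lax, eulerOp, loweringOp, raisingOp, Matrix.mul_apply, Fin.sum_univ_two,
      Fin.zero_eta, Fin.mk_one, Matrix.of_apply, Matrix.cons_val', Matrix.cons_val_zero,
      Matrix.cons_val_one, Matrix.cons_val_fin_one, LinearMap.add_apply, LinearMap.sub_apply,
      LinearMap.neg_apply, end_smul_apply, Module.End.mul_apply, Module.End.one_apply, Zm_apply,
      Dm_apply, map_add, map_sub, map_neg, map_mul, map_one, Derivation.leibniz, pderiv_C,
      Derivation.map_one_eq_zero, pderiv_X_self, pderiv_X_of_ne hij, pderiv_X_of_ne hij.symm, smul_eq_mul,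
      pderiv_pderiv_comm j i] <;>
    ring

/-- `D` exchanges the second parameters of `Lᵢ(p₁,p₂) Lⱼ(q₁,q₂)`. -/
lemma semiconjBy_Lax_mul_Lax_left {i j : Fin 2} (hij : i ≠ j) {D : Module.End ℂ (MvPolynomial (Fin 2) ℂ)}
    {c : ℕ → ℂ}
    (hD : ∀ m k : ℕ, D (X j ^ m * (X i - X j) ^ k) = c k • (X j ^ m * (X i - X j) ^ k))
    {p₁ p₂ q₁ q₂ : ℂ}
    (hc : ∀ k : ℕ, c (k + 1) * (k + (p₁ - p₂)) = (k + (p₁ - q₂)) * c k) :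
    SemiconjBy (SM D) (Lax i p₁ p₂ * Lax j q₁ q₂) (Lax i p₁ q₂ * Lax j q₁ p₂) := by
  have hZ : SemiconjBy D (Zm j) (Zm j) := commute_Zm hij hD
  have hT : SemiconjBy D (Dm i + Dm j) (Dm i + Dm j) := commute_Dm_add_Dm hij hD
  have hE : SemiconjBy D (eulerOp i j) (eulerOp i j) := commute_eulerOp hij hD
  have hU := semiconjBy_raisingOp hij hD hc
  have hL := semiconjBy_loweringOp hij hD hc
  have hZT := hZ.mul_right hT
  have hET := hE.mul_right hT
  rw [Lax_mul_Lax_left hij, Lax_mul_Lax_left hij, mul_comm q₂ p₂,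
    show q₁ + p₂ + q₂ - p₁ + 1 = q₁ + q₂ + p₂ - p₁ + 1 by ring,
    show p₁ - q₂ - p₂ - 1 = p₁ - p₂ - q₂ - 1 by ring]
  refine semiconjBy_SM ?_ ?_ ?_ ?_
  · exact (((((SemiconjBy.one_right D).end_smul_right _).add_right (hZT.end_smul_right _)).add_right
      (hE.end_smul_right _)).add_right (hZ.mul_right hET)).sub_right (hZ.mul_right hL)
  · exact (hL.sub_right (hT.end_smul_right _)).sub_right hET
  · exact ((((((hU.end_smul_right _).add_right (hZ.mul_right (hU.mul_right hT))).sub_right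
      (hZ.mul_right (hZ.mul_right hL))).sub_right (hZ.mul_right (hE.mul_right hE))).add_right
      ((hZ.mul_right hE).end_smul_right _)).add_right (hZ.mul_right (hZ.mul_right hET))).add_right
      ((hZ.mul_right hZT).end_smul_right _) |>.add_right (hZ.end_smul_right _)
  · exact ((((((SemiconjBy.one_right D).end_smul_right _).add_right (hZ.mul_right hL)).sub_right
      (hZ.mul_right hET)).sub_right (hZT.end_smul_right _)).sub_right (hU.mul_right hT)).add_right
      (hE.mul_right hE) |>.add_right (hE.end_smul_right _)

/-- `D` exchanges the first parameters of `Lⱼ(p₁,p₂) Lᵢ(q₁,q₂)`. -/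
lemma semiconjBy_Lax_mul_Lax_right {i j : Fin 2} (hij : i ≠ j) {D : Module.End ℂ (MvPolynomial (Fin 2) ℂ)}
    {c : ℕ → ℂ}
    (hD : ∀ m k : ℕ, D (X j ^ m * (X i - X j) ^ k) = c k • (X j ^ m * (X i - X j) ^ k))
    {p₁ p₂ q₁ q₂ : ℂ}
    (hc : ∀ k : ℕ, c (k + 1) * (k + (q₁ - q₂)) = (k + (p₁ - q₂)) * c k) :
    SemiconjBy (SM D) (Lax j p₁ p₂ * Lax i q₁ q₂) (Lax j q₁ p₂ * Lax i p₁ q₂) := by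
  have hZ : SemiconjBy D (Zm j) (Zm j) := commute_Zm hij hD
  have hT : SemiconjBy D (Dm i + Dm j) (Dm i + Dm j) := commute_Dm_add_Dm hij hD
  have hE : SemiconjBy D (eulerOp i j) (eulerOp i j) := commute_eulerOp hij hD
  have hU := semiconjBy_raisingOp hij hD hc
  have hL := semiconjBy_loweringOp hij hD hc
  have hZT := hZ.mul_right hT
  have hET := hE.mul_right hT
  rw [Lax_mul_Lax_right hij, Lax_mul_Lax_right hij, mul_comm q₁ p₁,
    show q₁ + p₂ + p₁ - q₂ - 1 = p₁ + p₂ + q₁ - q₂ - 1 by ring, add_comm q₁ p₁]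
  refine semiconjBy_SM ?_ ?_ ?_ ?_
  · exact ((((((SemiconjBy.one_right D).end_smul_right _).add_right (hZ.mul_right hL)).sub_right
      (hZ.mul_right hET)).add_right (hZT.end_smul_right _)).sub_right (hU.mul_right hT)).add_right
      (hE.mul_right hE) |>.add_right (hE.end_smul_right _)
  · exact (hET.sub_right (hT.end_smul_right _)).sub_right hL
  · exact ((((((hU.end_smul_right _).sub_right (hZ.mul_right (hU.mul_right hT))).add_right
      (hZ.mul_right (hZ.mul_right hL))).add_right (hZ.mul_right (hE.mul_right hE))).add_right
      ((hZ.mul_right hE).end_smul_right _)).sub_right (hZ.mul_right (hZ.mul_right hET))).add_right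
      ((hZ.mul_right hZT).end_smul_right _) |>.add_right (hZ.end_smul_right _)
  · exact (((((SemiconjBy.one_right D).end_smul_right _).add_right (hZ.mul_right hET)).sub_right
      (hZ.mul_right hL)).sub_right (hE.end_smul_right _)).sub_right (hZT.end_smul_right _)

lemma Gamma_ratio_succ {a b : ℂ} (ha : ∀ n : ℕ, a ≠ -(n : ℂ)) (hb : ∀ n : ℕ, b ≠ -(n : ℂ))
    (k : ℕ) :
    Complex.Gamma (((k + 1 : ℕ) : ℂ) + a) / Complex.Gamma (((k + 1 : ℕ) : ℂ) + b) * (k + b)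
      = (k + a) * (Complex.Gamma (k + a) / Complex.Gamma (k + b)) := by
  have ha' : (k : ℂ) + a ≠ 0 := fun h => ha k (by linear_combination h)
  have hb' : (k : ℂ) + b ≠ 0 := fun h => hb k (by linear_combination h)
  have hG : Complex.Gamma (k + b) ≠ 0 := Complex.Gamma_ne_zero fun n h =>
    hb (n + k) (by push_cast; linear_combination h)
  rw [show ((k + 1 : ℕ) : ℂ) + a = k + a + 1 by push_cast; ring,
    show ((k + 1 : ℕ) : ℂ) + b = k + b + 1 by push_cast; ring,
    Complex.Gamma_add_one _ ha', Complex.Gamma_add_one _ hb']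
  field_simp

/-- The factorized operator `Ř = D₂[u₁−u₂, v₁−u₂] ∘ D₁[u₁−v₂, u₁−u₂]`, where
`D₂[α,β]` acts diagonally on the basis `z₁ʲ(z₂−z₁)ᵏ` with eigenvalue `Γ(k+α)/Γ(k+β)` and
`D₁[α,β]` acts diagonally on the basis `z₂ʲ(z₁−z₂)ᵏ` with eigenvalue `Γ(k+α)/Γ(k+β)`,
satisfies the full defining equation of the `sl(2)` R-matrix:
`Ř L₁(u₁,u₂) L₂(v₁,v₂) = L₁(v₁,v₂) L₂(u₁,u₂) Ř`. -/
theorem R_factorized_defining_equation (u₁ u₂ v₁ v₂ : ℂ)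
    (h₁ : ∀ n : ℕ, u₁ - u₂ ≠ -(n : ℂ)) (h₂ : ∀ n : ℕ, v₁ - u₂ ≠ -(n : ℂ))
    (h₃ : ∀ n : ℕ, u₁ - v₂ ≠ -(n : ℂ))
    (R₂ R₁ : Module.End ℂ (MvPolynomial (Fin 2) ℂ))
    (hR₂ : ∀ j k : ℕ,
      R₂ ((X 0) ^ j * (X 1 - X 0) ^ k)
        = (Complex.Gamma ((k : ℂ) + (u₁ - u₂)) / Complex.Gamma ((k : ℂ) + (v₁ - u₂)))
            • ((X 0) ^ j * (X 1 - X 0) ^ k))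
    (hR₁ : ∀ j k : ℕ,
      R₁ ((X 1) ^ j * (X 0 - X 1) ^ k)
        = (Complex.Gamma ((k : ℂ) + (u₁ - v₂)) / Complex.Gamma ((k : ℂ) + (u₁ - u₂)))
            • ((X 1) ^ j * (X 0 - X 1) ^ k)) :
    SM (R₂ * R₁) * (Lax 0 u₁ u₂ * Lax 1 v₁ v₂)
      = Lax 0 v₁ v₂ * Lax 1 u₁ u₂ * SM (R₂ * R₁) := by
  have hS₁ := semiconjBy_Lax_mul_Lax_left (i := 0) (j := 1) (q₁ := v₁) (by decide) hR₁
    (Gamma_ratio_succ h₃ h₁)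
  have hS₂ := semiconjBy_Lax_mul_Lax_right (i := 1) (j := 0) (p₂ := v₂) (by decide) hR₂
    (Gamma_ratio_succ h₁ h₂)
  have hSM : SM (R₂ * R₁) = SM R₂ * SM R₁ := map_mul (Matrix.scalar (Fin 2)) R₂ R₁
  rw [hSM]
  exact hS₂.mul_left hS₁
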